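/- For every m ≥ 1 and u ∈ ℂ, m! • h_m(u) equals the row-determinant Σ_{σ ∈ S_m} sgn(σ) M_{1,σ(1)} * M_{2,σ(2)} * ⋯ * M_{m,σ(m)} (factors multiplied in increasing row order) of the m×m matrix M over A whose entries are: M_{i,j} = p⁺_{i−j+1}(u+j−1) for 1 ≤ j ≤ i ≤ m, M_{i,i+1} = −i • 1_A, and M_{i,j} = 0 for j > i+1. -/

import Mathlib

/-- Matrices in the `k`-leg model over `A`: square matrices indexed by functions
`Fin k → Fin n`, a model of `End((ℂ^n)^⊗k) ⊗ A`. -/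
abbrev LegMatrix (n k : ℕ) (A : Type*) := Matrix (Fin k → Fin n) (Fin k → Fin n) A

variable {n : ℕ} {A : Type*} [Ring A] [Algebra ℂ A]

/-- `T_s(v)`: the generating matrix `T(v)` placed on leg `s` of the `k`-leg model. -/
def Tleg (T : ℂ → Matrix (Fin n) (Fin n) A) {k : ℕ} (s : Fin k) (v : ℂ) :
    LegMatrix n k A := fun f g =>
  if ∀ t : Fin k, t ≠ s → f t = g t then T v (f s) (g s) else 0

/-- The permutation matrix `P_σ` of a permutation `σ` of the legs:
its `(f,g)`-entry is `1` (via `algebraMap ℂ A`) if `f = g ∘ σ` and `0` otherwise. -/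
def Pleg (n : ℕ) (A : Type*) [Ring A] [Algebra ℂ A] {k : ℕ} (σ : Equiv.Perm (Fin k)) :
    LegMatrix n k A := fun f g => if f = g ∘ σ then algebraMap ℂ A 1 else 0

/-- The transposition of legs with 1-based labels `i`, `j` (identity if out of range;
all uses are in range). -/
def legSwap (k i j : ℕ) : Equiv.Perm (Fin k) :=
  if h : 1 ≤ i ∧ i ≤ k ∧ 1 ≤ j ∧ j ≤ k then
    Equiv.swap ⟨i - 1, by omega⟩ ⟨j - 1, by omega⟩ else 1

/-- The antisymmetrizer `A_k = (1/k!) • Σ_σ sgn(σ) • P_σ` in the `k`-leg model. -/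
noncomputable def Aleg (n : ℕ) (A : Type*) [Ring A] [Algebra ℂ A] (k : ℕ) :
    LegMatrix n k A :=
  ((k.factorial : ℂ))⁻¹ •
    ∑ σ : Equiv.Perm (Fin k), ((Equiv.Perm.sign σ : ℤ) : ℂ) • Pleg n A σ

/-- The symmetrizer `S_k = (1/k!) • Σ_σ P_σ` in the `k`-leg model. -/
noncomputable def Sleg (n : ℕ) (A : Type*) [Ring A] [Algebra ℂ A] (k : ℕ) :
    LegMatrix n k A :=
  ((k.factorial : ℂ))⁻¹ • ∑ σ : Equiv.Perm (Fin k), Pleg n A σ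

/-- The ordered product `T_1(u) * T_2(u+d) * ⋯ * T_k(u+(k−1)d)` in the `k`-leg model. -/
noncomputable def TT (T : ℂ → Matrix (Fin n) (Fin n) A) (k : ℕ) (u d : ℂ) :
    LegMatrix n k A :=
  ((List.finRange k).map (fun s => Tleg T s (u + d * ((s : ℕ) : ℂ)))).prod

/-- The RTT relation of the Yangian of `gl_n`:
`((u−v) • 1 − P_{1,2}) T_1(u) T_2(v) = T_2(v) T_1(u) ((u−v) • 1 − P_{1,2})`
in the 2-leg model. -/
def RTT (T : ℂ → Matrix (Fin n) (Fin n) A) : Prop :=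
  ∀ u v : ℂ,
    ((u - v) • (1 : LegMatrix n 2 A) - Pleg n A (legSwap 2 1 2)) *
        Tleg T (0 : Fin 2) u * Tleg T (1 : Fin 2) v =
      Tleg T (1 : Fin 2) v * Tleg T (0 : Fin 2) u *
        ((u - v) • (1 : LegMatrix n 2 A) - Pleg n A (legSwap 2 1 2))

/-- The elementary symmetric function
`e_k(u) = trace(A_k * T_1(u) * T_2(u−1) * ⋯ * T_k(u−k+1))`; for `k = 0` this is `1`. -/
noncomputable def esym (T : ℂ → Matrix (Fin n) (Fin n) A) (k : ℕ) (u : ℂ) : A :=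
  Matrix.trace (Aleg n A k * TT T k u (-1))

/-- The homogeneous symmetric function
`h_k(u) = trace(S_k * T_1(u) * T_2(u+1) * ⋯ * T_k(u+k−1))`; for `k = 0` this is `1`. -/
noncomputable def hsym (T : ℂ → Matrix (Fin n) (Fin n) A) (k : ℕ) (u : ℂ) : A :=
  Matrix.trace (Sleg n A k * TT T k u 1)

/-- The power sum `p⁻_k(u) = trace(T(u) * T(u−1) * ⋯ * T(u−k+1))`,
an ordinary product of `n×n` matrices over `A`. -/
noncomputable def pminus (T : ℂ → Matrix (Fin n) (Fin n) A) (k : ℕ) (u : ℂ) : A :=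
  Matrix.trace (((List.finRange k).map (fun i => T (u - ((i : ℕ) : ℂ)))).prod)

/-- The power sum `p⁺_k(u) = trace(T(u) * T(u+1) * ⋯ * T(u+k−1))`,
an ordinary product of `n×n` matrices over `A`. -/
noncomputable def pplus (T : ℂ → Matrix (Fin n) (Fin n) A) (k : ℕ) (u : ℂ) : A :=
  Matrix.trace (((List.finRange k).map (fun i => T (u + ((i : ℕ) : ℂ)))).prod)

open Equiv

/-! ### Permutations of `Fin (m + 1)` in terms of permutations of `Fin m` -/

/-- The extension of a permutation of `Fin m` to `Fin (m + 1)` fixing the last point. -/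
def extendLast {m : ℕ} (τ : Perm (Fin m)) : Perm (Fin (m + 1)) :=
  finSuccEquivLast.symm.permCongr (optionCongr τ)

@[simp]
lemma extendLast_castSucc {m : ℕ} (τ : Perm (Fin m)) (i : Fin m) :
    extendLast τ i.castSucc = (τ i).castSucc := by
  simp [extendLast]

@[simp]
lemma extendLast_last {m : ℕ} (τ : Perm (Fin m)) :
    extendLast τ (Fin.last m) = Fin.last m := by
  simp [extendLast]

lemma extendLast_inv {m : ℕ} (τ : Perm (Fin m)) : extendLast τ⁻¹ = (extendLast τ)⁻¹ := by
  rw [eq_inv_iff_mul_eq_one]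
  ext i
  induction i using Fin.lastCases <;> simp

lemma sign_extendLast {m : ℕ} (τ : Perm (Fin m)) :
    Perm.sign (extendLast τ) = Perm.sign τ := by
  rw [extendLast, Perm.sign_permCongr, optionCongr_sign]

/-- Split a sum over permutations according to the image of the last point. -/
lemma sum_perm_succ_image {M : Type*} [AddCommMonoid M] {m : ℕ} (F : Perm (Fin (m + 1)) → M) :
    ∑ σ, F σ = ∑ τ, F (extendLast τ) +
      ∑ k : Fin m, ∑ τ, F (swap (Fin.last m) k.castSucc * extendLast τ) := by
  have key : ∀ (o : Option (Fin m)) (τ : Perm (Fin m)),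
      finSuccEquivLast.symm.permCongr (Perm.decomposeOption.symm (o, τ)) =
        swap (Fin.last m) (finSuccEquivLast.symm o) * extendLast τ := by
    intro o τ
    ext1 x
    simp [Perm.decomposeOption_symm_apply, extendLast, ← finSuccEquivLast_symm_none,
      finSuccEquivLast.symm.injective.swap_apply]
  rw [← Equiv.sum_comp ((Perm.decomposeOption (α := Fin m)).symm.trans
    (finSuccEquivLast.symm.permCongr)) F, Fintype.sum_prod_type, Fintype.sum_option]
  simp only [Equiv.trans_apply, key, finSuccEquivLast_symm_none, finSuccEquivLast_symm_some,
    swap_self]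
  rfl

/-- Split a sum over permutations according to the preimage of the last point. -/
lemma sum_perm_succ_preimage {M : Type*} [AddCommMonoid M] {m : ℕ}
    (F : Perm (Fin (m + 1)) → M) :
    ∑ σ, F σ = ∑ τ, F (extendLast τ) +
      ∑ k : Fin m, ∑ τ, F (extendLast τ * swap (Fin.last m) k.castSucc) := by
  rw [← Equiv.sum_comp (Equiv.inv (Perm (Fin (m + 1)))) F, sum_perm_succ_image]
  congr 1
  · rw [← Equiv.sum_comp (Equiv.inv (Perm (Fin m))) fun τ => F (extendLast τ)]
    simp [extendLast_inv]
  · refine Finset.sum_congr rfl fun k _ => ?_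
    rw [← Equiv.sum_comp (Equiv.inv (Perm (Fin m)))
      fun τ => F (extendLast τ * swap (Fin.last m) k.castSucc)]
    simp [extendLast_inv]

/-! ### Ordered products -/

lemma prod_finRange_succ_last {R : Type*} [Monoid R] {m : ℕ} (F : Fin (m + 1) → R) :
    ((List.finRange (m + 1)).map F).prod =
      ((List.finRange m).map fun i => F i.castSucc).prod * F (Fin.last m) := by
  simp [List.finRange_succ_last, Function.comp_def]

/-- The list `0, 1, …, m` cut around two neighbouring positions. -/
lemma finRange_split_adjacent {m : ℕ} (p : Fin m) :
    ∃ x y : List (Fin (m + 1)),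
      (∀ i ∈ x, i ≠ p.castSucc ∧ i ≠ p.succ) ∧ (∀ i ∈ y, i ≠ p.castSucc ∧ i ≠ p.succ) ∧
      List.finRange (m + 1) = x ++ p.castSucc :: p.succ :: y := by
  have h : List.finRange (m + 1) = (List.finRange (m + 1)).take p ++
      p.castSucc :: p.succ :: (List.finRange (m + 1)).drop (p + 2) := by
    conv_lhs => rw [← List.take_append_drop p (List.finRange (m + 1))]
    rw [List.drop_eq_getElem_cons (by simp), List.drop_eq_getElem_cons (by simp)]
    simp only [List.getElem_finRange]
    rfl
  refine ⟨_, _, ?_, ?_, h⟩ <;>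
  · have hd := List.nodup_finRange (m + 1)
    rw [h] at hd
    simp only [List.nodup_append, List.nodup_cons, List.mem_cons] at hd
    grind

/-! ### The symmetrized ordered product -/

/-- The noncommutative permanent `∑_σ ∏_i T(u+i)_{a(σ i), b(i)}`. -/
noncomputable def ordPerm (T : ℂ → Matrix (Fin n) (Fin n) A) (u : ℂ) {m : ℕ}
    (a b : Fin m → Fin n) : A :=
  ∑ σ : Perm (Fin m),
    ((List.finRange m).map fun i : Fin m => T (u + ((i : ℕ) : ℂ)) (a (σ i)) (b i)).prod

lemma ordPerm_comp_left {R : Type*} [Ring R] (T : ℂ → Matrix (Fin n) (Fin n) R) (u : ℂ) {m : ℕ}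
    (a b : Fin m → Fin n) (ρ : Perm (Fin m)) : ordPerm T u (a ∘ ρ) b = ordPerm T u a b :=
  Equiv.sum_comp (Equiv.mulLeft ρ) fun σ : Perm (Fin m) =>
    ((List.finRange m).map fun i : Fin m => T (u + ((i : ℕ) : ℂ)) (a (σ i)) (b i)).prod

/-- Entries of an ordered product of `T`-matrices placed on distinct legs. -/
lemma prod_Tleg_apply {R : Type*} [Ring R] (T : ℂ → Matrix (Fin n) (Fin n) R) {k : ℕ}
    (v : Fin k → ℂ) (l : List (Fin k)) (hl : l.Nodup) (f g : Fin k → Fin n) :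
    (l.map fun s => Tleg T s (v s)).prod f g =
      if ∀ t, t ∉ l → f t = g t then (l.map fun s => T (v s) (f s) (g s)).prod else 0 := by
  induction l generalizing f with
  | nil => simp [Matrix.one_apply, funext_iff]
  | cons s l ih =>
    obtain ⟨hs, hl⟩ := List.nodup_cons.mp hl
    rw [List.map_cons, List.prod_cons, Matrix.mul_apply,
      Finset.sum_eq_single (Function.update f s (g s))]
    · have hmap : (l.map fun t => T (v t) (Function.update f s (g s) t) (g t)) =
          l.map fun t => T (v t) (f t) (g t) := by
        refine List.map_congr_left fun t ht => ?_
        rw [Function.update_of_ne (by rintro rfl; exact hs ht)]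
      have hiff : (∀ t, t ∉ l → Function.update f s (g s) t = g t) ↔
          ∀ t, t ∉ s :: l → f t = g t := by
        refine forall_congr' fun t => ?_
        by_cases hts : t = s
        · subst hts; simp
        · simp [hts]
      rw [ih hl, hmap]
      simp only [hiff]
      rw [Tleg, if_pos (fun t ht => by rw [Function.update_of_ne ht])]
      simp
    · intro h _ hne
      rw [Tleg, ih hl]
      split_ifs with h1 h2
      · refine absurd (funext fun t => ?_) hne
        by_cases hts : t = s
        · subst hts; simp [h2 _ hs]
        · rw [Function.update_of_ne hts, h1 t hts]
      all_goals simp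
    · simp

lemma TT_one_apply {R : Type*} [Ring R] (T : ℂ → Matrix (Fin n) (Fin n) R) (k : ℕ) (u : ℂ)
    (f g : Fin k → Fin n) :
    TT T k u 1 f g = ((List.finRange k).map fun i : Fin k => T (u + ((i : ℕ) : ℂ)) (f i) (g i)).prod := by
  rw [TT, prod_Tleg_apply T (fun s => u + 1 * ((s : ℕ) : ℂ)) _ (List.nodup_finRange k)]
  simp

lemma Pleg_mul_apply {k : ℕ} (σ : Perm (Fin k)) (X : LegMatrix n k A) (f g : Fin k → Fin n) :
    (Pleg n A σ * X) f g = X (f ∘ σ.symm) g := by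
  rw [Matrix.mul_apply, Finset.sum_eq_single (f ∘ σ.symm)]
  · simp [Pleg, Function.comp_assoc]
  · intro h _ hne
    rw [Pleg, if_neg, zero_mul]
    rintro rfl
    simp [Function.comp_assoc] at hne
  · simp

lemma mul_Pleg_apply {k : ℕ} (σ : Perm (Fin k)) (X : LegMatrix n k A) (f g : Fin k → Fin n) :
    (X * Pleg n A σ) f g = X f (g ∘ σ) := by
  simp [Matrix.mul_apply, Pleg]

/-- `m! h_m(u)` as a sum of noncommutative permanents. -/
lemma factorial_smul_hsym (T : ℂ → Matrix (Fin n) (Fin n) A) (m : ℕ) (u : ℂ) :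
    (m.factorial : ℂ) • hsym T m u = ∑ f : Fin m → Fin n, ordPerm T u f f := by
  have hm : (m.factorial : ℂ) ≠ 0 := by exact_mod_cast m.factorial_ne_zero
  rw [hsym, Sleg, smul_mul_assoc, Matrix.trace_smul, smul_inv_smul₀ hm, Matrix.trace]
  refine Finset.sum_congr rfl fun f _ => ?_
  rw [Matrix.diag_apply, Finset.sum_mul, Matrix.sum_apply, ordPerm,
    ← Equiv.sum_comp (Equiv.inv (Perm (Fin m)))]
  refine Finset.sum_congr rfl fun σ _ => ?_
  rw [Pleg_mul_apply, TT_one_apply]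
  rfl

/-- The row-symmetrized product of two neighbouring generators is symmetric in the columns. -/
lemma RTT.row_symm_mul (T : ℂ → Matrix (Fin n) (Fin n) A) (hT : RTT T) (u : ℂ)
    (a b c d : Fin n) :
    T u a c * T (u + 1) b d + T u b c * T (u + 1) a d =
      T u a d * T (u + 1) b c + T u b d * T (u + 1) a c := by
  have h01 : ∀ f g : Fin 2 → Fin n, (Tleg T 0 u * Tleg T 1 (u + 1) : LegMatrix n 2 A) f g =
      T u (f 0) (g 0) * T (u + 1) (f 1) (g 1) := fun f g => by
    simpa [Fin.forall_fin_two] using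
      prod_Tleg_apply T ![u, u + 1] [0, 1] (by decide) f g
  have h10 : ∀ f g : Fin 2 → Fin n, (Tleg T 1 (u + 1) * Tleg T 0 u : LegMatrix n 2 A) f g =
      T (u + 1) (f 1) (g 1) * T u (f 0) (g 0) := fun f g => by
    simpa [Fin.forall_fin_two] using
      prod_Tleg_apply T ![u, u + 1] [1, 0] (by decide) f g
  have hs : legSwap 2 1 2 = swap 0 1 := by simp [legSwap]
  have key : ∀ c d, T u a c * T (u + 1) b d + T u b c * T (u + 1) a d =
      T (u + 1) b d * T u a c + T (u + 1) b c * T u a d := fun c d => by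
    have h := congrFun (congrFun (hT u (u + 1)) ![a, b]) ![c, d]
    rw [mul_assoc] at h
    simp only [sub_mul, mul_sub, Matrix.sub_apply, Pleg_mul_apply, mul_Pleg_apply,
      smul_mul_assoc, mul_smul_comm, one_mul, mul_one, Matrix.smul_apply, h01, h10, hs] at h
    simp at h
    rw [← neg_inj]
    simp only [neg_add, ← sub_eq_add_neg]
    exact h
  rw [key c d, key d c, add_comm]

/-- The RTT relation makes the noncommutative permanent symmetric in the column indices. -/
lemma ordPerm_comp_right (T : ℂ → Matrix (Fin n) (Fin n) A) (hT : RTT T) (u : ℂ) {m : ℕ}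
    (a b : Fin m → Fin n) (ρ : Perm (Fin m)) : ordPerm T u a (b ∘ ρ) = ordPerm T u a b := by
  cases m with
  | zero => rw [Subsingleton.elim (b ∘ ρ) b]
  | succ m =>
    have hρ : ρ ∈ Submonoid.closure (Set.range fun i : Fin m => swap i.castSucc i.succ) := by
      rw [Perm.mclosure_swap_castSucc_succ]; trivial
    induction hρ using Submonoid.closure_induction generalizing b with
    | one => rfl
    | mul x y _ _ hx hy => rw [Perm.coe_mul, ← Function.comp_assoc, hy, hx]
    | mem x hx =>
      obtain ⟨p, rfl⟩ := hx
      obtain ⟨x, y, hx, hy, hxy⟩ := finRange_split_adjacent p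
      set s := swap p.castSucc p.succ with hs
      have two : ∀ b, (2 : ℂ) • ordPerm T u a b = ∑ σ : Perm (Fin (m + 1)),
          (((List.finRange (m + 1)).map fun i : Fin (m + 1) =>
            T (u + ((i : ℕ) : ℂ)) (a (σ i)) (b i)).prod +
          ((List.finRange (m + 1)).map fun i : Fin (m + 1) =>
            T (u + ((i : ℕ) : ℂ)) (a (σ (s i))) (b i)).prod) := by
        intro b
        rw [Finset.sum_add_distrib, two_smul]
        congr 1
        exact (Equiv.sum_comp (Equiv.mulRight s) fun σ : Perm (Fin (m + 1)) =>
          ((List.finRange (m + 1)).map fun i : Fin (m + 1) =>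
            T (u + ((i : ℕ) : ℂ)) (a (σ i)) (b i)).prod).symm
      refine smul_right_injective A (two_ne_zero (α := ℂ)) ?_
      simp only [two]
      refine Finset.sum_congr rfl fun σ _ => ?_
      have hsx : ∀ i ∈ x, s i = i := fun i hi => swap_apply_of_ne_of_ne (hx i hi).1 (hx i hi).2
      have hsy : ∀ i ∈ y, s i = i := fun i hi => swap_apply_of_ne_of_ne (hy i hi).1 (hy i hi).2
      have split : ∀ ρ ρ' : Perm (Fin (m + 1)),
          (∀ i ∈ x, ρ i = i) → (∀ i ∈ y, ρ i = i) → (∀ i ∈ x, ρ' i = i) → (∀ i ∈ y, ρ' i = i) →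
          ((List.finRange (m + 1)).map fun i : Fin (m + 1) =>
            T (u + ((i : ℕ) : ℂ)) (a (σ (ρ i))) (b (ρ' i))).prod =
          (x.map fun i : Fin (m + 1) =>
            T (u + ((i : ℕ) : ℂ)) (a (σ i)) (b i)).prod *
          ((T (u + ((p : ℕ) : ℂ)) (a (σ (ρ p.castSucc))) (b (ρ' p.castSucc)) *
            T (u + ((p : ℕ) : ℂ) + 1) (a (σ (ρ p.succ))) (b (ρ' p.succ))) *
          (y.map fun i : Fin (m + 1) =>
            T (u + ((i : ℕ) : ℂ)) (a (σ i)) (b i)).prod) := by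
        intro ρ ρ' h1 h2 h3 h4
        rw [hxy]
        simp only [List.map_append, List.map_cons, List.prod_append, List.prod_cons]
        rw [List.map_congr_left (l := x) fun i hi => by rw [h1 i hi, h3 i hi],
          List.map_congr_left (l := y) fun i hi => by rw [h2 i hi, h4 i hi]]
        simp [mul_assoc, add_assoc]
      have e11 := split 1 1 (by simp) (by simp) (by simp) (by simp)
      have es1 := split s 1 hsx hsy (by simp) (by simp)
      have e1s := split 1 s (by simp) (by simp) hsx hsy
      have ess := split s s hsx hsy hsx hsy
      simp only [Perm.coe_one, id_eq] at e11 es1 e1s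
      simp only [Function.comp_apply]
      rw [e11, es1, e1s, ess, ← mul_add, ← add_mul, ← mul_add, ← add_mul]
      congr 2
      simp only [hs, swap_apply_left, swap_apply_right]
      exact (RTT.row_symm_mul T hT _ _ _ _ _).symm

/-! ### Replacing the last factor by an arbitrary matrix -/

/-- The trace of `(m + 1)! S_{m+1} T_1(u) ⋯ T_m(u+m-1) X_{m+1}` for a matrix `X` placed on the
last leg. -/
noncomputable def symTrace (T : ℂ → Matrix (Fin n) (Fin n) A) (u : ℂ) (m : ℕ)
    (X : Matrix (Fin n) (Fin n) A) : A :=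
  ∑ f : Fin (m + 1) → Fin n, ∑ σ : Perm (Fin (m + 1)),
    ((List.finRange m).map fun i : Fin m =>
      T (u + ((i : ℕ) : ℂ)) (f (σ i.castSucc)) (f i.castSucc)).prod *
      X (f (σ (Fin.last m))) (f (Fin.last m))

lemma symTrace_self {R : Type*} [Ring R] (T : ℂ → Matrix (Fin n) (Fin n) R) (u : ℂ) (m : ℕ) :
    symTrace T u m (T (u + m)) = ∑ f : Fin (m + 1) → Fin n, ordPerm T u f f := by
  simp [symTrace, ordPerm, prod_finRange_succ_last]

lemma symTrace_zero {R : Type*} [Ring R] (T : ℂ → Matrix (Fin n) (Fin n) R) (u : ℂ)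
    (X : Matrix (Fin n) (Fin n) R) : symTrace T u 0 X = X.trace := by
  rw [symTrace, Matrix.trace, ← Equiv.sum_comp (Equiv.funUnique (Fin 1) (Fin n)).symm]
  simp

lemma sum_fun_snoc {M : Type*} [AddCommMonoid M] {m : ℕ} (F : (Fin (m + 1) → Fin n) → M) :
    ∑ f, F f = ∑ g : Fin m → Fin n, ∑ x, F (Fin.snoc g x) := by
  rw [← Equiv.sum_comp (Fin.snocEquiv fun _ : Fin (m + 1) => Fin n) F, Fintype.sum_prod_type,
    Finset.sum_comm]
  rfl

lemma sum_fun_comp_perm {M ι : Type*} [AddCommMonoid M] [Fintype ι] [DecidableEq ι]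
    (ρ : Perm ι) (F : (ι → Fin n) → M) : ∑ f, F (f ∘ ρ) = ∑ f, F f :=
  Equiv.sum_comp (ρ.symm.arrowCongr (Equiv.refl (Fin n))) F

/-- Newton-type recursion: split off the cycle structure of the last leg. -/
lemma symTrace_succ (T : ℂ → Matrix (Fin n) (Fin n) A) (hT : RTT T) (u : ℂ) (m : ℕ)
    (X : Matrix (Fin n) (Fin n) A) :
    symTrace T u (m + 1) X = (∑ f : Fin (m + 1) → Fin n, ordPerm T u f f) * X.trace +
      (m + 1) • symTrace T u m (T (u + m) * X) := by
  have hsplit : symTrace T u (m + 1) X =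
      ∑ f : Fin (m + 2) → Fin n,
        ordPerm T u (f ∘ Fin.castSucc) (f ∘ Fin.castSucc) * X (f (Fin.last _)) (f (Fin.last _)) +
      ∑ k : Fin (m + 1), ∑ f : Fin (m + 2) → Fin n,
        ordPerm T u (f ∘ swap (Fin.last _) k.castSucc ∘ Fin.castSucc) (f ∘ Fin.castSucc) *
          X (f k.castSucc) (f (Fin.last _)) := by
    rw [Finset.sum_comm, ← Finset.sum_add_distrib, symTrace]
    refine Finset.sum_congr rfl fun f _ => ?_
    rw [sum_perm_succ_image]
    simp [ordPerm, Finset.sum_mul]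
  have hlast : ∀ k : Fin (m + 1), ∑ f : Fin (m + 2) → Fin n,
        ordPerm T u (f ∘ swap (Fin.last _) k.castSucc ∘ Fin.castSucc) (f ∘ Fin.castSucc) *
          X (f k.castSucc) (f (Fin.last _)) =
      symTrace T u m (T (u + m) * X) := by
    intro k
    set l := Fin.last m with hl
    have hρ : ∀ i : Fin (m + 1), swap k.castSucc l.castSucc i.castSucc = (swap k l i).castSucc :=
      fun i => (Fin.castSucc_injective _).swap_apply _ _ _
    have hρl : swap k.castSucc l.castSucc (Fin.last (m + 1)) = Fin.last (m + 1) :=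
      swap_apply_of_ne_of_ne (Fin.castSucc_lt_last _).ne' (Fin.castSucc_lt_last _).ne'
    calc _ = ∑ f : Fin (m + 2) → Fin n,
          ordPerm T u (f ∘ swap (Fin.last _) l.castSucc ∘ Fin.castSucc) (f ∘ Fin.castSucc) *
            X (f l.castSucc) (f (Fin.last _)) := by
          rw [← sum_fun_comp_perm (swap k.castSucc l.castSucc)]
          refine Finset.sum_congr rfl fun f _ => ?_
          congr 1
          · rw [← ordPerm_comp_left T u (f ∘ swap (Fin.last _) l.castSucc ∘ Fin.castSucc) _
                (swap k l),
              ← ordPerm_comp_right T hT u _ (f ∘ Fin.castSucc) (swap k l)]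
            congr 1
            · funext i
              simp only [Function.comp_apply, ← hρ]
              congr 1
              rw [← (swap k.castSucc l.castSucc).injective.swap_apply, hρl, swap_apply_left]
            · funext i
              simp only [Function.comp_apply, ← hρ]
          · simp [hρl]
      _ = ∑ f : Fin (m + 2) → Fin n,
          ordPerm T u (f ∘ Fin.castSucc) (f ∘ swap (Fin.last _) l.castSucc ∘ Fin.castSucc) *
            X (f (Fin.last _)) (f l.castSucc) := by
          rw [← sum_fun_comp_perm (swap (Fin.last _) l.castSucc)]
          refine Finset.sum_congr rfl fun f _ => ?_
          simp [Function.comp_def]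
      _ = _ := by
          rw [sum_fun_snoc, symTrace]
          refine Finset.sum_congr rfl fun g _ => ?_
          simp only [ordPerm, Finset.sum_mul]
          rw [Finset.sum_comm]
          refine Finset.sum_congr rfl fun τ _ => ?_
          rw [Matrix.mul_apply, Finset.mul_sum]
          refine Finset.sum_congr rfl fun x _ => ?_
          have hi : ∀ i : Fin m, swap (Fin.last (m + 1)) l.castSucc i.castSucc.castSucc =
              i.castSucc.castSucc := fun i => swap_apply_of_ne_of_ne
            (Fin.castSucc_lt_last _).ne (by simp [hl, Fin.ext_iff, i.2.ne])
          have hlm : (l : ℕ) = m := rfl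
          simp [prod_finRange_succ_last, hi, hlm, ← hl, mul_assoc]
  rw [hsplit, Finset.sum_congr rfl fun k _ => hlast k]
  congr 1
  · rw [sum_fun_snoc, Finset.sum_mul]
    refine Finset.sum_congr rfl fun g _ => ?_
    simp [Matrix.trace, Finset.mul_sum, Function.comp_def]
  · simp

/-! ### The row-determinant -/

/-- The row-determinant of the `m × m` matrix with entries `M i j`, factors in increasing row
order. -/
noncomputable def rowDet (M : ℕ → ℕ → A) (m : ℕ) : A :=
  ∑ σ : Perm (Fin m), (Perm.sign σ : ℤ) •
    ((List.finRange m).map fun i : Fin m => M i (σ i)).prod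

/-- The row-determinant of the `(m + 1) × (m + 1)` matrix with rows `M 0, …, M (m - 1), c`. -/
noncomputable def rowDetSnoc (M : ℕ → ℕ → A) (m : ℕ) (c : ℕ → A) : A :=
  ∑ σ : Perm (Fin (m + 1)), (Perm.sign σ : ℤ) •
    (((List.finRange m).map fun i : Fin m => M i (σ i.castSucc)).prod * c (σ (Fin.last m)))

section RowDet

variable {R : Type*} [Ring R] (M : ℕ → ℕ → R) (m : ℕ)

lemma rowDet_succ : rowDet M (m + 1) = rowDetSnoc M m (M m) := by
  simp [rowDet, rowDetSnoc, prod_finRange_succ_last]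

lemma rowDetSnoc_congr {c d : ℕ → R} (h : ∀ i ≤ m, c i = d i) :
    rowDetSnoc M m c = rowDetSnoc M m d := by
  refine Finset.sum_congr rfl fun σ _ => ?_
  rw [h _ (Fin.is_le _)]

lemma rowDetSnoc_zero (c : ℕ → R) : rowDetSnoc M 0 c = c 0 := by
  simp [rowDetSnoc]

/-- Expansion along the last column for a Hessenberg matrix whose superdiagonal entries are
`-1, -2, …`. -/
lemma rowDetSnoc_succ (hM : ∀ i, M i (i + 1) = -((i + 1 : ℕ) : R))
    (hM0 : ∀ i j, i + 1 < j → M i j = 0) (c : ℕ → R) :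
    rowDetSnoc M (m + 1) c = rowDet M (m + 1) * c (m + 1) + (m + 1) • rowDetSnoc M m c := by
  rw [rowDetSnoc, sum_perm_succ_preimage]
  congr 1
  · simp [rowDet, Finset.sum_mul, sign_extendLast, mul_assoc]
  · rw [Finset.sum_eq_single (Fin.last m), rowDetSnoc, Finset.smul_sum]
    · refine Finset.sum_congr rfl fun τ _ => ?_
      have hi : ∀ i : Fin m, swap (Fin.last (m + 1)) (Fin.last m).castSucc i.castSucc.castSucc =
          i.castSucc.castSucc := fun i => swap_apply_of_ne_of_ne
        (Fin.castSucc_lt_last _).ne (by simp [Fin.ext_iff, i.2.ne])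
      have hsign : Perm.sign (swap (Fin.last (m + 1)) (Fin.last m).castSucc) = -1 :=
        Perm.sign_swap (Fin.castSucc_lt_last _).ne'
      rw [prod_finRange_succ_last]
      simp only [Perm.mul_apply, hi, extendLast_castSucc, extendLast_last, swap_apply_left,
        swap_apply_right, Perm.sign_mul, sign_extendLast, hsign, Fin.val_last, Fin.val_castSucc,
        hM]
      simp only [mul_one, Units.val_neg, neg_smul, mul_neg, neg_mul, smul_neg, neg_neg]
      rw [← (Nat.cast_commute (m + 1) _).eq, mul_assoc, ← nsmul_eq_mul, smul_comm]
    · intro k _ hk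
      refine Finset.sum_eq_zero fun τ _ => ?_
      rw [List.prod_eq_zero, zero_mul, smul_zero]
      refine List.mem_map.mpr ⟨k, List.mem_finRange k, ?_⟩
      apply hM0
      have : (k : ℕ) < m := Fin.val_lt_last hk
      simpa using this
    · simp

end RowDet

/-! ### Comparison -/

/-- The ordinary ordered matrix product `T(v) T(v+1) ⋯ T(v+k-1)`. -/
noncomputable def shiftProd (T : ℂ → Matrix (Fin n) (Fin n) A) (k : ℕ) (v : ℂ) :
    Matrix (Fin n) (Fin n) A :=
  ((List.finRange k).map fun i : Fin k => T (v + ((i : ℕ) : ℂ))).prod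

lemma shiftProd_succ {R : Type*} [Ring R] (T : ℂ → Matrix (Fin n) (Fin n) R) (k : ℕ) (v : ℂ) :
    shiftProd T (k + 1) v = shiftProd T k v * T (v + k) := by
  simp [shiftProd, prod_finRange_succ_last]

lemma pplus_eq_trace_shiftProd {R : Type*} [Ring R] (T : ℂ → Matrix (Fin n) (Fin n) R) (k : ℕ)
    (v : ℂ) : pplus T k v = (shiftProd T k v).trace := by
  simp [pplus, shiftProd, List.map_eq_flatMap, List.flatMap_assoc]

/-- The entries of the power-sum matrix, with zero-based indices. -/
noncomputable def powerSumEntry (T : ℂ → Matrix (Fin n) (Fin n) A) (u : ℂ) (i j : ℕ) : A :=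
  if j ≤ i then pplus T (i - j + 1) (u + (j : ℂ))
  else if j = i + 1 then -((i + 1 : ℕ) : A) else 0

lemma symTrace_eq_rowDetSnoc (T : ℂ → Matrix (Fin n) (Fin n) A) (hT : RTT T) (u : ℂ) (m : ℕ)
    (X : Matrix (Fin n) (Fin n) A) :
    symTrace T u m X = rowDetSnoc (powerSumEntry T u) m
      fun i => (shiftProd T (m - i) (u + i) * X).trace := by
  have hmul : ∀ m i : ℕ, i ≤ m → shiftProd T (m + 1 - i) (u + i) =
      shiftProd T (m - i) (u + i) * T (u + m) := fun m i hi => by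
    rw [Nat.sub_add_comm hi, shiftProd_succ, Nat.cast_sub hi, add_add_sub_cancel]
  induction m generalizing X with
  | zero => simp [symTrace_zero, rowDetSnoc_zero, shiftProd]
  | succ m ih =>
    rw [symTrace_succ T hT, rowDetSnoc_succ, ← symTrace_self, ih, ih, rowDet_succ]
    · congr 2
      · refine rowDetSnoc_congr _ _ fun i hi => ?_
        rw [powerSumEntry, if_pos hi, ← hmul m i hi, Nat.sub_add_comm hi,
          pplus_eq_trace_shiftProd]
      · rw [Nat.sub_self]
        simp [shiftProd]
      · refine rowDetSnoc_congr _ _ fun i hi => ?_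
        rw [hmul m i hi, mul_assoc]
    · intro i
      simp [powerSumEntry]
    · intro i j hij
      rw [powerSumEntry, if_neg (by omega), if_neg (by omega)]

/-- `m! • h_m(u)` equals the row-determinant of the `m×m` matrix `M` with
(1-based) entries `M_{i,j} = p⁺_{i−j+1}(u+j−1)` for `j ≤ i`, `M_{i,i+1} = −i • 1`,
and `M_{i,j} = 0` for `j > i+1`.  (Below `i`, `j` are 0-based.) -/
theorem factorial_hsym_eq_rowdet (hn : 1 ≤ n) (T : ℂ → Matrix (Fin n) (Fin n) A)
    (hT : RTT T) (m : ℕ) (hm : 1 ≤ m) (u : ℂ) :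
    (m.factorial : ℂ) • hsym T m u =
      ∑ σ : Equiv.Perm (Fin m), ((Equiv.Perm.sign σ : ℤ) : ℂ) •
        ((List.finRange m).map (fun i : Fin m =>
          if ((σ i : ℕ)) ≤ (i : ℕ) then
            pplus T ((i : ℕ) - (σ i : ℕ) + 1) (u + ((σ i : ℕ) : ℂ))
          else if ((σ i : ℕ)) = (i : ℕ) + 1 then -(((i : ℕ) + 1 : ℕ) : A)
          else 0)).prod := by
  rw [factorial_smul_hsym]
  obtain ⟨k, rfl⟩ : ∃ k, m = k + 1 := ⟨m - 1, by omega⟩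
  have h : symTrace T u k (T (u + k)) = rowDet (powerSumEntry T u) (k + 1) := by
    rw [symTrace_eq_rowDetSnoc T hT, rowDet_succ]
    refine rowDetSnoc_congr _ _ fun i hi => ?_
    rw [powerSumEntry, if_pos hi, pplus_eq_trace_shiftProd, shiftProd_succ,
      Nat.cast_sub hi, add_add_sub_cancel]
  rw [← symTrace_self, h, rowDet]
  refine Finset.sum_congr rfl fun σ _ => ?_
  rw [Int.cast_smul_eq_zsmul]
  rfl
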